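/- arXiv:2106.06185 — 3 statements merged into one kernel-verified Lean document; each statement's English description precedes it below -/
import Mathlib

section
/- Under Assumption (A), write a := σ²+(σ⁰)². The consistency equation π = (h − θγσ⁰·𝔼[σ⁰π]) / ((1−γ)a) (an equation for a real-valued essentially bounded random variable π) has exactly one essentially bounded solution up to almost sure equality, namely π* = h/((1−γ)a) − (θγσ⁰/((1−γ)a)) · 𝔼[hσ⁰/((1−γ)a)] / (1 + 𝔼[θγ(σ⁰)²/((1−γ)a)]). Moreover 𝔼[σ⁰π*] = 𝔼[hσ⁰/((1−γ)a)] / (1 + 𝔼[θγ(σ⁰)²/((1−γ)a)]). -/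
open MeasureTheory ProbabilityTheory

/-- Best-response consistency characterization of the unique Nash equilibrium strategy of
Theorem 3.11: the consistency equation `π = (h - θγσ⁰·𝔼[σ⁰π])/((1-γ)a)` has exactly one
essentially bounded solution up to a.s. equality, namely `π*`, and moreover
`𝔼[σ⁰π*] = 𝔼[hσ⁰/((1-γ)a)]/(1 + 𝔼[θγ(σ⁰)²/((1-γ)a)])`. -/
theorem stmt3
    {Ω : Type*} [m0 : MeasurableSpace Ω] (P : Measure Ω) [IsProbabilityMeasure P]
    (θ γ σ σ0 h : Ω → ℝ)
    (hθm : Measurable θ) (hγm : Measurable γ) (hσm : Measurable σ)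
    (hσ0m : Measurable σ0) (hhm : Measurable h)
    (κ ε Γ C : ℝ) (hκ : 0 < κ) (hε : 0 < ε)
    (hbdd : ∀ᵐ ω ∂P, |h ω| ≤ C ∧ |σ ω| ≤ C ∧ |σ0 ω| ≤ C)
    (hθ01 : ∀ᵐ ω ∂P, θ ω ∈ Set.Icc (0 : ℝ) 1)
    (hγ0 : ∀ᵐ ω ∂P, γ ω ≠ 0)
    (hγκ : ∀ᵐ ω ∂P, γ ω ≤ 1 - κ)
    (ha : ∀ᵐ ω ∂P, ε ≤ (σ ω) ^ 2 + (σ0 ω) ^ 2)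
    (hΓ : ∀ᵐ ω ∂P, |γ ω| ≤ Γ) :
    let a : Ω → ℝ := fun ω => (σ ω) ^ 2 + (σ0 ω) ^ 2
    let πstar : Ω → ℝ := fun ω =>
      h ω / ((1 - γ ω) * a ω) - (θ ω * γ ω * σ0 ω / ((1 - γ ω) * a ω)) *
        ((∫ ω', h ω' * σ0 ω' / ((1 - γ ω') * a ω') ∂P) /
          (1 + ∫ ω', θ ω' * γ ω' * (σ0 ω') ^ 2 / ((1 - γ ω') * a ω') ∂P))
    (∀ π : Ω → ℝ, Measurable π → (∃ C', ∀ᵐ ω ∂P, |π ω| ≤ C') →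
      ((∀ᵐ ω ∂P, π ω =
          (h ω - θ ω * γ ω * σ0 ω * ∫ ω', σ0 ω' * π ω' ∂P) / ((1 - γ ω) * a ω)) ↔
        π =ᵐ[P] πstar)) ∧
    (∫ ω, σ0 ω * πstar ω ∂P) =
      (∫ ω', h ω' * σ0 ω' / ((1 - γ ω') * a ω') ∂P) /
        (1 + ∫ ω', θ ω' * γ ω' * (σ0 ω') ^ 2 / ((1 - γ ω') * a ω') ∂P) := by
  intro a πstar
  have hD : ∀ᵐ ω ∂P, κ * ε ≤ (1 - γ ω) * a ω := by
    filter_upwards [hγκ, ha] with ω h1 h2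
    exact mul_le_mul (by linarith) h2 hε.le (by linarith)
  have hκε : 0 < κ * ε := mul_pos hκ hε
  have hΓ0 : 0 ≤ Γ := by
    obtain ⟨ω, hω⟩ := hΓ.exists
    exact (abs_nonneg _).trans hω
  have hIA : Integrable (fun ω => h ω * σ0 ω / ((1 - γ ω) * a ω)) P := by
    refine Integrable.of_bound (C := C * C / (κ * ε))
      (Measurable.aestronglyMeasurable (by fun_prop)) ?_
    filter_upwards [hD, hbdd] with ω h1 h2
    have hC : 0 ≤ C := (abs_nonneg _).trans h2.1
    rw [Real.norm_eq_abs, abs_div, abs_mul, abs_of_pos (hκε.trans_le h1)]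
    exact div_le_div₀ (by positivity)
      (mul_le_mul h2.1 h2.2.2 (abs_nonneg _) hC) hκε h1
  have hIB : Integrable (fun ω => θ ω * γ ω * (σ0 ω) ^ 2 / ((1 - γ ω) * a ω)) P := by
    refine Integrable.of_bound (C := 1 * Γ * C ^ 2 / (κ * ε))
      (Measurable.aestronglyMeasurable (by fun_prop)) ?_
    filter_upwards [hD, hbdd, hθ01, hΓ] with ω h1 h2 h3 h4
    have hC : 0 ≤ C := (abs_nonneg _).trans h2.1
    rw [Real.norm_eq_abs, abs_div, abs_mul, abs_mul, abs_pow, abs_of_pos (hκε.trans_le h1),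
      abs_of_nonneg h3.1]
    refine div_le_div₀ (by positivity) ?_ hκε h1
    have h5 := h2.2.2
    have h6 := h3.2
    gcongr
  have key : ∀ (m : ℝ) (π : Ω → ℝ),
      (∀ᵐ ω ∂P, π ω = h ω / ((1 - γ ω) * a ω) - (θ ω * γ ω * σ0 ω / ((1 - γ ω) * a ω)) * m) →
      (∫ ω, σ0 ω * π ω ∂P) = (∫ ω', h ω' * σ0 ω' / ((1 - γ ω') * a ω') ∂P) -
        (∫ ω', θ ω' * γ ω' * (σ0 ω') ^ 2 / ((1 - γ ω') * a ω') ∂P) * m := by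
    intro m π hπ
    rw [← integral_mul_const, ← integral_sub hIA (hIB.mul_const m)]
    refine integral_congr_ae ?_
    filter_upwards [hπ] with ω h1
    rw [h1]
    ring
  have hB : 0 < 1 + ∫ ω', θ ω' * γ ω' * (σ0 ω') ^ 2 / ((1 - γ ω') * a ω') ∂P := by
    have h0 : (∫ _ω, (-Γ / (1 + Γ)) ∂P) ≤
        ∫ ω', θ ω' * γ ω' * (σ0 ω') ^ 2 / ((1 - γ ω') * a ω') ∂P := by
      refine integral_mono_ae (integrable_const _) hIB ?_
      filter_upwards [hγκ, ha, hθ01, hΓ] with ω h1 h2 h3 h4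
      have ha0 : 0 < a ω := hε.trans_le h2
      have h5 : 0 < 1 - γ ω := by linarith
      have hr0 : 0 ≤ θ ω * ((σ0 ω) ^ 2 / a ω) := mul_nonneg h3.1 (by positivity)
      have hr1 : θ ω * ((σ0 ω) ^ 2 / a ω) ≤ 1 := by
        refine mul_le_one₀ h3.2 (by positivity) ?_
        rw [div_le_one ha0]
        have := sq_nonneg (σ ω)
        change (σ0 ω) ^ 2 ≤ (σ ω) ^ 2 + (σ0 ω) ^ 2
        linarith
      have hg : -Γ / (1 + Γ) ≤ γ ω / (1 - γ ω) := by
        rw [div_le_div_iff₀ (by linarith) h5]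
        nlinarith [neg_abs_le (γ ω)]
      have hg0 : -Γ / (1 + Γ) ≤ 0 :=
        div_nonpos_of_nonpos_of_nonneg (by linarith) (by linarith)
      have e : θ ω * γ ω * (σ0 ω) ^ 2 / ((1 - γ ω) * a ω) =
          (θ ω * ((σ0 ω) ^ 2 / a ω)) * (γ ω / (1 - γ ω)) := by
        field_simp
      change _ ≤ θ ω * γ ω * (σ0 ω) ^ 2 / ((1 - γ ω) * a ω)
      rw [e]
      nlinarith [mul_le_mul_of_nonneg_left hg hr0]
    have h1 : (-1 : ℝ) < -Γ / (1 + Γ) := by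
      rw [lt_div_iff₀ (by linarith)]
      linarith
    simp only [integral_const, probReal_univ, one_smul] at h0
    linarith
  have hsol : ∀ π : Ω → ℝ, π =ᵐ[P] πstar → (∫ ω, σ0 ω * π ω ∂P) =
      (∫ ω', h ω' * σ0 ω' / ((1 - γ ω') * a ω') ∂P) /
        (1 + ∫ ω', θ ω' * γ ω' * (σ0 ω') ^ 2 / ((1 - γ ω') * a ω') ∂P) := by
    intro π hπ
    rw [key _ π hπ]
    field_simp
    ring
  refine ⟨fun π _ _ => ⟨fun hπ => ?_, fun hπ => ?_⟩, hsol πstar (Filter.EventuallyEq.refl _ _)⟩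
  · have hπ2 : ∀ᵐ ω ∂P, π ω = h ω / ((1 - γ ω) * a ω) -
        (θ ω * γ ω * σ0 ω / ((1 - γ ω) * a ω)) * ∫ ω', σ0 ω' * π ω' ∂P := by
      filter_upwards [hπ] with ω h1
      rw [h1]
      ring
    have hm := key _ π hπ2
    have hm2 : (∫ ω, σ0 ω * π ω ∂P) =
      (∫ ω', h ω' * σ0 ω' / ((1 - γ ω') * a ω') ∂P) /
        (1 + ∫ ω', θ ω' * γ ω' * (σ0 ω') ^ 2 / ((1 - γ ω') * a ω') ∂P) := by
      rw [eq_div_iff hB.ne']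
      linarith
    rw [hm2] at hπ2
    exact hπ2
  · rw [hsol π hπ]
    filter_upwards [hπ] with ω h1
    rw [h1]
    simp only [πstar]
    ring
end

section
/- Let N ≥ 2 and, for i = 1,…,N, let hⁱ, σⁱ, σⁱ⁰, γⁱ, θⁱ be real numbers with γⁱ < 1, γⁱ ≠ 0, θⁱ ∈ [0,1], aⁱ := (σⁱ)²+(σⁱ⁰)² > 0, and suppose δⁱ := (1−γⁱ)aⁱ − θⁱγⁱ(σⁱ⁰)²/(N−1) > 0 for every i. Set φ¹ := (1/(N−1))·Σ_{j=1}^N hʲσʲ⁰/δʲ and φ² := (1/(N−1))·Σ_{j=1}^N θʲγʲ(σʲ⁰)²/δʲ. Then 1 + φ² > 0, and the linear system (1−γⁱ)aⁱ·πⁱ = hⁱ − (θⁱγⁱσⁱ⁰/(N−1))·Σ_{j≠i} σʲ⁰πʲ (i = 1,…,N) has a unique solution (π¹,…,πᴺ) ∈ ℝᴺ, given explicitly by πⁱ = hⁱ/δⁱ − (θⁱγⁱσⁱ⁰/δⁱ)·φ¹/(1 + φ²). -/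
/-- The explicit Nash equilibrium of Theorem 5.1 for the `N`-player portfolio game with
deterministic market parameters (at a fixed time): under positivity of the `δⁱ`,
`1 + φ² > 0` and the linear best-response system
`(1-γⁱ)aⁱ·πⁱ = hⁱ - (θⁱγⁱσⁱ⁰/(N-1))·∑_{j≠i} σʲ⁰πʲ` has a unique solution, given explicitly
by `πⁱ = hⁱ/δⁱ - (θⁱγⁱσⁱ⁰/δⁱ)·φ¹/(1 + φ²)`. -/
theorem stmt6 (N : ℕ) (hN : 2 ≤ N)
    (h σ σ0 γ θ : Fin N → ℝ)
    (hγ1 : ∀ i, γ i < 1) (hγ0 : ∀ i, γ i ≠ 0) (hθ : ∀ i, θ i ∈ Set.Icc (0 : ℝ) 1)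
    (ha : ∀ i, 0 < (σ i) ^ 2 + (σ0 i) ^ 2)
    (hδ : ∀ i, 0 < (1 - γ i) * ((σ i) ^ 2 + (σ0 i) ^ 2)
      - θ i * γ i * (σ0 i) ^ 2 / ((N : ℝ) - 1)) :
    let a : Fin N → ℝ := fun i => (σ i) ^ 2 + (σ0 i) ^ 2
    let δ : Fin N → ℝ := fun i => (1 - γ i) * a i - θ i * γ i * (σ0 i) ^ 2 / ((N : ℝ) - 1)
    let φ1 : ℝ := (1 / ((N : ℝ) - 1)) * ∑ j, h j * σ0 j / δ j
    let φ2 : ℝ := (1 / ((N : ℝ) - 1)) * ∑ j, θ j * γ j * (σ0 j) ^ 2 / δ j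
    0 < 1 + φ2 ∧
    ∀ π : Fin N → ℝ,
      (∀ i, (1 - γ i) * a i * π i =
        h i - θ i * γ i * σ0 i / ((N : ℝ) - 1) * ∑ j ∈ Finset.univ.erase i, σ0 j * π j) ↔
      (∀ i, π i = h i / δ i - (θ i * γ i * σ0 i / δ i) * (φ1 / (1 + φ2))) := by
  intro a δ φ1 φ2
  have hM : (0 : ℝ) < (N : ℝ) - 1 := by
    have : (2 : ℝ) ≤ N := by exact_mod_cast hN
    linarith
  have hNpos : (0 : ℝ) < N := by linarith
  have hδ' : ∀ i, 0 < δ i := hδ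
  have hδe : ∀ i, δ i = (1 - γ i) * a i - θ i * γ i * (σ0 i) ^ 2 / ((N : ℝ) - 1) := fun i => rfl
  have hae : ∀ i, a i = (σ i) ^ 2 + (σ0 i) ^ 2 := fun i => rfl
  have hap : ∀ i, 0 < a i := ha
  have h1 : ((N : ℝ) - 1) * φ1 = ∑ j, h j * σ0 j / δ j := by
    simp only [φ1]; field_simp
  have h2 : ((N : ℝ) - 1) * φ2 = ∑ j, θ j * γ j * (σ0 j) ^ 2 / δ j := by
    simp only [φ2]; field_simp
  clear_value φ1 φ2 δ a
  generalize hMe : (N : ℝ) - 1 = M at *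
  have hpos : 0 < 1 + φ2 := by
    have key : ∀ i, -(M / N) < θ i * γ i * (σ0 i) ^ 2 / δ i := by
      intro i
      have hc : 0 < (1 - γ i) * a i + θ i * γ i * (σ0 i) ^ 2 := by
        obtain ⟨t0, t1⟩ := hθ i
        have hg := hγ1 i
        have hai := hap i
        rcases le_or_gt 0 (γ i) with g | g
        · have := mul_pos (sub_pos.2 hg) hai
          have : 0 ≤ θ i * γ i * (σ0 i) ^ 2 := by positivity
          linarith
        · have e1 : 0 ≤ (-γ i) * (1 - θ i) * (σ0 i) ^ 2 :=
            mul_nonneg (mul_nonneg (by linarith) (by linarith)) (sq_nonneg _)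
          have e2 : 0 ≤ (-γ i) * (σ i) ^ 2 := mul_nonneg (by linarith) (sq_nonneg _)
          have := hae i
          rw [this] at hai ⊢
          nlinarith
      have hd : M * δ i = M * ((1 - γ i) * a i) - θ i * γ i * (σ0 i) ^ 2 := by
        rw [hδe]; field_simp
      rw [lt_div_iff₀ (hδ' i), neg_mul, div_mul_eq_mul_div, neg_lt, lt_div_iff₀ hNpos, hd]
      have hNM : (N : ℝ) = M + 1 := by linarith
      rw [hNM]
      nlinarith [mul_pos hM hc]
    have hs : ∑ _j : Fin N, (-(M / (N : ℝ))) < ∑ j, θ j * γ j * (σ0 j) ^ 2 / δ j :=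
      Finset.sum_lt_sum_of_nonempty ⟨⟨0, by omega⟩, Finset.mem_univ _⟩ (fun i _ => key i)
    rw [← h2] at hs
    have he : ∑ _j : Fin N, (-(M / (N : ℝ))) = -M := by
      simp; field_simp
    rw [he] at hs
    by_contra hcon
    nlinarith
  refine ⟨hpos, fun π => ?_⟩
  have hsys : ∀ i, ((1 - γ i) * a i * π i =
        h i - θ i * γ i * σ0 i / M * ∑ j ∈ Finset.univ.erase i, σ0 j * π j) ↔
      π i = h i / δ i - (θ i * γ i * σ0 i / δ i) * ((∑ j, σ0 j * π j) / M) := by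
    intro i
    have he : ∑ j ∈ Finset.univ.erase i, σ0 j * π j = (∑ j, σ0 j * π j) - σ0 i * π i := by
      rw [← Finset.add_sum_erase _ _ (Finset.mem_univ i)]; ring
    rw [he]
    generalize (∑ j, σ0 j * π j) = S
    have hd := (hδ' i).ne'
    have e : h i / δ i - (θ i * γ i * σ0 i / δ i) * (S / M)
        = (h i - θ i * γ i * σ0 i / M * S) / δ i := by
      field_simp
    rw [e, eq_div_iff hd, hδe]
    constructor
    · intro H; linear_combination H
    · intro H; linear_combination H
  have hsum : ∀ t, (∀ i, π i = h i / δ i - (θ i * γ i * σ0 i / δ i) * t) →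
      ∑ j, σ0 j * π j = M * φ1 - M * φ2 * t := by
    intro t ht
    rw [h1, h2, Finset.sum_mul, ← Finset.sum_sub_distrib]
    refine Finset.sum_congr rfl fun j _ => ?_
    rw [ht j]; ring
  rw [forall_congr' hsys]
  constructor
  · intro H
    have hS := hsum _ H
    have : (∑ j, σ0 j * π j) / M = φ1 / (1 + φ2) := by
      generalize (∑ j, σ0 j * π j) = S at hS ⊢
      rw [div_eq_div_iff hM.ne' hpos.ne']
      field_simp at hS
      linear_combination hS
    rwa [this] at H
  · intro H
    have hS := hsum _ H
    have : (∑ j, σ0 j * π j) / M = φ1 / (1 + φ2) := by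
      rw [hS]; have := hpos.ne'
      field_simp
      ring
    rwa [this]
end

section
/- Let T > 0, let (Ω, 𝓕, ℙ) be a probability space, let 𝒜 be a sub-σ-algebra, and let W, W⁰ be real-valued random variables each with Gaussian law of mean 0 and variance T, such that 𝒜, σ(W), σ(W⁰) are mutually independent. Let x, h, σ, σ⁰ and p be bounded 𝒜-measurable random variables with x ≥ ε′ > 0 almost surely, and set a := σ²+(σ⁰)². Define X^p := x·exp((ph − p²a/2)T + pσW + pσ⁰W⁰). Then, almost surely, 𝔼[log X^p | σ(W⁰)] = 𝔼[log x] + 𝔼[ph − p²a/2]·T + 𝔼[pσ⁰]·W⁰. -/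
open MeasureTheory ProbabilityTheory

lemma core_aux {Ω : Type*} (mA : MeasurableSpace Ω) [m0 : MeasurableSpace Ω]
    (P : Measure Ω) [IsProbabilityMeasure P] (hmA : mA ≤ m0)
    (W W0 : Ω → ℝ) (hWm : Measurable W) (hW0m : Measurable W0)
    (hWi : Integrable W P) (hW0i : Integrable W0 P) (hW : ∫ ω, W ω ∂P = 0)
    (hmutual : iIndep
      ![mA, MeasurableSpace.comap W inferInstance, MeasurableSpace.comap W0 inferInstance] P)
    (u v w : Ω → ℝ) (hu : Measurable[mA] u) (hv : Measurable[mA] v) (hw : Measurable[mA] w)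
    (hui : Integrable u P) (hvi : Integrable v P) (hwi : Integrable w P) :
    P[(u + v * W) + w * W0 | MeasurableSpace.comap W0 inferInstance]
      =ᵐ[P] fun ω => (∫ ω', u ω' ∂P) + (∫ ω', w ω' ∂P) * W0 ω := by
  have hle : MeasurableSpace.comap W0 inferInstance ≤ m0 := hW0m.comap_le
  have hleW : MeasurableSpace.comap W inferInstance ≤ m0 := hWm.comap_le
  have i01 : Indep mA (MeasurableSpace.comap W inferInstance) P :=
    hmutual.indep (i := 0) (j := 1) (by decide)
  have i02 : Indep mA (MeasurableSpace.comap W0 inferInstance) P :=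
    hmutual.indep (i := 0) (j := 2) (by decide)
  have i012 : Indep (mA ⊔ MeasurableSpace.comap W inferInstance)
      (MeasurableSpace.comap W0 inferInstance) P := by
    have := indep_iSup_of_disjoint (S := {0, 1}) (T := {2}) (by
      intro i; fin_cases i
      · exact hmA
      · exact hleW
      · exact hle) hmutual (by simp)
    simpa [iSup_insert, iSup_or, iSup_sup_eq] using this
  have ivW : IndepFun v W P := by
    rw [IndepFun_iff_Indep]
    exact indep_of_indep_of_le_left i01 hv.comap_le
  have iwW0 : IndepFun w W0 P := by
    rw [IndepFun_iff_Indep]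
    exact indep_of_indep_of_le_left i02 hw.comap_le
  have hvW := ivW.integrable_mul hvi hWi
  have hwW0 := iwW0.integrable_mul hwi hW0i
  have hWW : Measurable[mA ⊔ MeasurableSpace.comap W inferInstance] W :=
    (comap_measurable W).mono le_sup_right le_rfl
  have hm1 : Measurable[mA ⊔ MeasurableSpace.comap W inferInstance] (u + v * W) :=
    (hu.mono le_sup_left le_rfl).add ((hv.mono le_sup_left le_rfl).mul hWW)
  have e1 := condExp_indep_eq (sup_le hmA hleW) hle hm1.stronglyMeasurable i012
  have e2 := condExp_mul_of_stronglyMeasurable_right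
    (comap_measurable W0).stronglyMeasurable hwW0 hwi
  have e3 := condExp_indep_eq hmA hle hw.stronglyMeasurable i02
  have e4 : ∫ ω, (u + v * W) ω ∂P = ∫ ω, u ω ∂P := by
    have h1 := integral_add' hui hvW
    have h2 := ivW.integral_mul_eq_mul_integral hvi.1 hWi.1
    rw [h1, h2, hW]; simp
  filter_upwards [condExp_add (hui.add hvW) hwW0 (MeasurableSpace.comap W0 inferInstance),
    e1, e2, e3] with ω h1 h2 h3 h4
  rw [h1, Pi.add_apply, h2, h3, Pi.mul_apply, h4, e4]



/-- Mean field aggregation computation (proofs of Proposition 3.9 and Theorem 3.11): the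
conditional expectation of the terminal log-wealth given the common noise satisfies, a.s.,
`𝔼[log X^p | σ(W⁰)] = 𝔼[log x] + 𝔼[ph - p²a/2]·T + 𝔼[pσ⁰]·W⁰`. -/
theorem stmt14
    {Ω : Type*} (mA : MeasurableSpace Ω) [m0 : MeasurableSpace Ω]
    (P : Measure Ω) [IsProbabilityMeasure P] (hmA : mA ≤ m0)
    (T : ℝ) (hT : 0 < T)
    (W W0 : Ω → ℝ) (hWm : Measurable W) (hW0m : Measurable W0)
    (hWlaw : Measure.map W P = gaussianReal 0 T.toNNReal)
    (hW0law : Measure.map W0 P = gaussianReal 0 T.toNNReal)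
    (hmutual : iIndep
      ![mA, MeasurableSpace.comap W inferInstance, MeasurableSpace.comap W0 inferInstance] P)
    (x h σ σ0 p : Ω → ℝ)
    (hxm : Measurable[mA] x) (hhm : Measurable[mA] h) (hσm : Measurable[mA] σ)
    (hσ0m : Measurable[mA] σ0) (hpm : Measurable[mA] p)
    (ε' C : ℝ) (hε' : 0 < ε')
    (hbdd : ∀ ω, |x ω| ≤ C ∧ |h ω| ≤ C ∧ |σ ω| ≤ C ∧ |σ0 ω| ≤ C ∧ |p ω| ≤ C)
    (hx : ∀ᵐ ω ∂P, ε' ≤ x ω) :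
    let a : Ω → ℝ := fun ω => (σ ω) ^ 2 + (σ0 ω) ^ 2
    let X : Ω → ℝ := fun ω =>
      x ω * Real.exp ((p ω * h ω - (p ω) ^ 2 * a ω / 2) * T
        + p ω * σ ω * W ω + p ω * σ0 ω * W0 ω)
    P[fun ω => Real.log (X ω) | MeasurableSpace.comap W0 inferInstance]
      =ᵐ[P] fun ω => (∫ ω', Real.log (x ω') ∂P)
        + (∫ ω', p ω' * h ω' - (p ω') ^ 2 * a ω' / 2 ∂P) * T
        + (∫ ω', p ω' * σ0 ω' ∂P) * W0 ω := by

  intro a X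
  have gi : ∀ Z : Ω → ℝ, Measurable Z → Measure.map Z P = gaussianReal 0 T.toNNReal →
      Integrable Z P ∧ ∫ ω, Z ω ∂P = 0 := by
    intro Z hZ hl
    have h1 : Integrable (id : ℝ → ℝ) (Measure.map Z P) := by
      rw [hl, ← memLp_one_iff_integrable]
      exact memLp_id_gaussianReal' 1 (by simp)
    refine ⟨h1.comp_measurable hZ, ?_⟩
    have h2 := integral_map hZ.aemeasurable h1.1
    rw [hl] at h2
    simpa using h2.symm
  obtain ⟨hWi, hW0⟩ := gi W hWm hWlaw
  obtain ⟨hW0i, -⟩ := gi W0 hW0m hW0law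
  -- closure of bounded measurable functions
  have hxi : Integrable (fun ω => Real.log (x ω)) P := by
    refine Integrable.of_bound (C := |Real.log ε'| + |Real.log C|)
      ((hxm.mono hmA le_rfl).log.aestronglyMeasurable) ?_
    filter_upwards [hx] with ω hω
    have h1 := Real.log_le_log hε' hω
    have h2 := Real.log_le_log (hε'.trans_le hω) ((le_abs_self _).trans (hbdd ω).1)
    rw [Real.norm_eq_abs, abs_le]
    constructor
    · linarith [neg_abs_le (Real.log ε'), abs_nonneg (Real.log C)]
    · linarith [le_abs_self (Real.log C), abs_nonneg (Real.log ε')]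
  have mem : ∀ f : Ω → ℝ, Measurable[mA] f → (∀ ω, |f ω| ≤ C) → MemLp f ⊤ P := by
    intro f hf hb
    exact memLp_top_of_bound (hf.mono hmA le_rfl).aestronglyMeasurable C
      (Filter.Eventually.of_forall hb)
  have hhM := mem h hhm fun ω => (hbdd ω).2.1
  have hσM := mem σ hσm fun ω => (hbdd ω).2.2.1
  have hσ0M := mem σ0 hσ0m fun ω => (hbdd ω).2.2.2.1
  have hpM := mem p hpm fun ω => (hbdd ω).2.2.2.2
  have mulM : ∀ {f g : Ω → ℝ}, MemLp f ⊤ P → MemLp g ⊤ P → MemLp (f * g) ⊤ P :=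
    fun hf hg => hg.mul hf
  have hqi : Integrable (fun ω' => p ω' * h ω' - (p ω') ^ 2 * a ω' / 2) P := by
    have h1 := (mulM hpM hhM).sub ((mulM (mulM hpM hpM)
      ((mulM hσM hσM).add (mulM hσ0M hσ0M))).mul_const (1 / 2))
    refine (h1.integrable le_top).congr (Filter.Eventually.of_forall fun ω => ?_)
    simp only [Pi.sub_apply, Pi.mul_apply, Pi.add_apply, a]
    ring
  have hqm : Measurable[mA] (fun ω' => p ω' * h ω' - (p ω') ^ 2 * a ω' / 2) :=
    (hpm.mul hhm).sub (((hpm.pow_const 2).mul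
      ((hσm.pow_const 2).add (hσ0m.pow_const 2))).div_const 2)
  have key := core_aux mA P hmA W W0 hWm hW0m hWi hW0i hW0 hmutual
    (fun ω => Real.log (x ω) + (p ω * h ω - (p ω) ^ 2 * a ω / 2) * T) (p * σ) (p * σ0)
    (hxm.log.add (hqm.mul_const T)) (hpm.mul hσm) (hpm.mul hσ0m)
    (hxi.add (hqi.mul_const T)) ((mulM hpM hσM).integrable le_top)
    ((mulM hpM hσ0M).integrable le_top)
  rw [integral_add hxi (hqi.mul_const T), integral_mul_const] at key
  refine (condExp_congr_ae ?_).trans key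
  filter_upwards [hx] with ω hω
  simp only [X, Pi.add_apply, Pi.mul_apply]
  rw [Real.log_mul (hε'.trans_le hω).ne' (Real.exp_ne_zero _), Real.log_exp]
  ring
end
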